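/- Let λ ∈ ℂ with Im(λ) < 0 (so that the multiplier q := exp(−2πiλ) satisfies |q| < 1), let R > 0, and let δ be holomorphic on {|v| < R} with δ(0) = 0. Define Δ(v) := v·exp(−2πiλ + δ(v)). Then there exists ρ ∈ (0, R] such that: Δ maps {|v| < ρ} into itself (so all iterates Δ^{∘n} are defined there); the series ψ := Σ_{n≥0} δ∘Δ^{∘n} converges uniformly on {|v| < ρ} to a holomorphic function with ψ(0) = 0; and the map Ψ(v) := v·exp ψ(v), which is holomorphic, tangent to the identity at 0 (Ψ(0)=0, Ψ′(0)=1), linearizes Δ: Ψ(Δ(v)) = exp(−2πiλ)·Ψ(v) for all |v| < ρ. -/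

import Mathlib

open Metric Filter

/-- Iterates of a map contracting a ball towards its center decay geometrically. -/
theorem norm_iterate_le_of_contracting {E : Type*} [SeminormedAddCommGroup E] {f : E → E}
    {k ρ : ℝ} (hk0 : 0 ≤ k) (hmaps : Set.MapsTo f (ball 0 ρ) (ball 0 ρ))
    (hf : ∀ v ∈ ball (0 : E) ρ, ‖f v‖ ≤ k * ‖v‖) (n : ℕ) {v : E} (hv : v ∈ ball (0 : E) ρ) :
    ‖f^[n] v‖ ≤ k ^ n * ‖v‖ := by
  induction n with
  | zero => simp
  | succ n ih =>
    rw [Function.iterate_succ_apply', pow_succ']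
    calc ‖f (f^[n] v)‖ ≤ k * ‖f^[n] v‖ := hf _ (hmaps.iterate n hv)
      _ ≤ k * (k ^ n * ‖v‖) := by gcongr
      _ = k * k ^ n * ‖v‖ := by ring

/-- A function differentiable at `0` and vanishing there is, on small balls, bounded both by a
multiple of the norm and by any prescribed positive constant. -/
theorem exists_ball_norm_le_of_differentiableAt {f : ℂ → ℂ} (hf : DifferentiableAt ℂ f 0)
    (hf0 : f 0 = 0) {R ε : ℝ} (hR : 0 < R) (hε : 0 < ε) :
    ∃ ρ C : ℝ, 0 < ρ ∧ ρ ≤ R ∧ 0 < C ∧ ∀ v ∈ ball (0 : ℂ) ρ, ‖f v‖ ≤ C * ‖v‖ ∧ ‖f v‖ ≤ ε := by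
  obtain ⟨C, hC, hbound⟩ := hf.isBigO_sub.exists_pos
  have hlim : Tendsto (fun v => ‖f v‖) (nhds 0) (nhds 0) := by
    simpa [hf0] using hf.continuousAt.norm.tendsto
  obtain ⟨r, hr, hball⟩ := eventually_nhds_iff_ball.mp
    (hbound.bound.and (hlim.eventually_le_const hε))
  refine ⟨min r R, C, lt_min hr hR, min_le_right _ _, hC, fun v hv => ?_⟩
  simpa [hf0] using hball v (ball_subset_ball (min_le_left _ _) hv)

/-- Koenig linearization of the hyperbolic holonomy
`Δ(v) = v·exp(−2πiλ + δ(v))`, `Im λ < 0`. There is a radius `ρ ≤ R` such that `Δ` maps the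
disk `{|v| < ρ}` into itself, the series `ψ = Σ_{n≥0} δ∘Δ^{∘n}` converges uniformly on it to a
holomorphic function vanishing at `0`, and `Ψ(v) = v·exp ψ(v)` is holomorphic, tangent to the
identity at `0`, and linearizes `Δ`: `Ψ∘Δ = exp(−2πiλ)·Ψ`. -/
theorem koenig_linearization (lam : ℂ) (hlam : lam.im < 0) (R : ℝ) (hR : 0 < R)
    (δ : ℂ → ℂ) (hδ : DifferentiableOn ℂ δ (ball (0 : ℂ) R)) (hδ0 : δ 0 = 0)
    (Δ : ℂ → ℂ)
    (hΔ : ∀ v : ℂ, Δ v = v * Complex.exp (-(2 * (Real.pi : ℂ) * Complex.I * lam) + δ v)) :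
    ∃ ρ : ℝ, 0 < ρ ∧ ρ ≤ R ∧
      Set.MapsTo Δ (ball (0 : ℂ) ρ) (ball (0 : ℂ) ρ) ∧
      ∃ ψ : ℂ → ℂ,
        TendstoUniformlyOn (fun N v => ∑ n ∈ Finset.range N, δ (Δ^[n] v)) ψ atTop
          (ball (0 : ℂ) ρ) ∧
        DifferentiableOn ℂ ψ (ball (0 : ℂ) ρ) ∧ ψ 0 = 0 ∧
        DifferentiableOn ℂ (fun v => v * Complex.exp (ψ v)) (ball (0 : ℂ) ρ) ∧
        (fun v => v * Complex.exp (ψ v)) 0 = 0 ∧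
        deriv (fun v => v * Complex.exp (ψ v)) 0 = 1 ∧
        ∀ v ∈ ball (0 : ℂ) ρ,
          Δ v * Complex.exp (ψ (Δ v))
            = Complex.exp (-(2 * (Real.pi : ℂ) * Complex.I * lam))
                * (v * Complex.exp (ψ v)) := by
  have hπ : 0 < -(Real.pi * lam.im) := by nlinarith [Real.pi_pos]
  obtain ⟨ρ, C, hρ, hρR, hC, hb⟩ := exists_ball_norm_le_of_differentiableAt
    (hδ.differentiableAt (ball_mem_nhds 0 hR)) hδ0 hR hπ
  set c : ℂ := -(2 * (Real.pi : ℂ) * Complex.I * lam) with hc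
  have hcre : c.re = 2 * (Real.pi * lam.im) := by
    simp [hc, Complex.mul_re, Complex.mul_im]
    ring
  set k : ℝ := Real.exp (Real.pi * lam.im)
  have hk0 : 0 ≤ k := (Real.exp_pos _).le
  have hk1 : k < 1 := Real.exp_lt_one_iff.mpr (by linarith)
  have hcontr : ∀ v ∈ ball (0 : ℂ) ρ, ‖Δ v‖ ≤ k * ‖v‖ := by
    intro v hv
    rw [hΔ, norm_mul, Complex.norm_exp, mul_comm]
    refine mul_le_mul_of_nonneg_right (Real.exp_le_exp.mpr ?_) (norm_nonneg v)
    have h := (Complex.re_le_norm (δ v)).trans (hb v hv).2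
    rw [Complex.add_re, hcre]
    linarith
  have hmaps : Set.MapsTo Δ (ball (0 : ℂ) ρ) (ball (0 : ℂ) ρ) := by
    intro v hv
    have h := hcontr v hv
    rw [mem_ball_zero_iff] at hv ⊢
    nlinarith [norm_nonneg v]
  have hδρ : DifferentiableOn ℂ δ (ball (0 : ℂ) ρ) := hδ.mono (ball_subset_ball hρR)
  have hΔdiff : DifferentiableOn ℂ Δ (ball (0 : ℂ) ρ) := by
    rw [funext hΔ]
    exact differentiableOn_id.mul (hδρ.const_add c).cexp
  have hterm : ∀ n, ∀ v ∈ ball (0 : ℂ) ρ, ‖δ (Δ^[n] v)‖ ≤ C * ρ * k ^ n := by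
    intro n v hv
    have hvρ : ‖v‖ ≤ ρ := (mem_ball_zero_iff.mp hv).le
    calc ‖δ (Δ^[n] v)‖ ≤ C * ‖Δ^[n] v‖ := (hb _ (hmaps.iterate n hv)).1
      _ ≤ C * (k ^ n * ρ) := by
        gcongr
        exact (norm_iterate_le_of_contracting hk0 hmaps hcontr n hv).trans (by gcongr)
      _ = C * ρ * k ^ n := by ring
  have hsum : Summable fun n : ℕ => C * ρ * k ^ n :=
    (summable_geometric_of_lt_one hk0 hk1).mul_left _
  set ψ : ℂ → ℂ := fun v => ∑' n, δ (Δ^[n] v) with hψ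
  have hunif : TendstoUniformlyOn (fun N v => ∑ n ∈ Finset.range N, δ (Δ^[n] v)) ψ atTop
      (ball (0 : ℂ) ρ) := tendstoUniformlyOn_tsum_nat hsum hterm
  have hψdiff : DifferentiableOn ℂ ψ (ball (0 : ℂ) ρ) := by
    refine hunif.tendstoLocallyUniformlyOn.differentiableOn (.of_forall fun N => ?_) isOpen_ball
    exact DifferentiableOn.fun_sum fun n _ =>
      hδρ.comp (hΔdiff.iterate hmaps n) (hmaps.iterate n)
  have hψ0 : ψ 0 = 0 := by
    have hfix : Function.IsFixedPt Δ 0 := by simp [Function.IsFixedPt, hΔ]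
    simp [hψ, fun n => (hfix.iterate n).eq, hδ0]
  have hψstep : ∀ v ∈ ball (0 : ℂ) ρ, ψ v = δ v + ψ (Δ v) := fun v hv =>
    (hsum.of_norm_bounded fun n => hterm n v hv).tsum_eq_zero_add
  refine ⟨ρ, hρ, hρR, hmaps, ψ, hunif, hψdiff, hψ0, differentiableOn_id.mul hψdiff.cexp,
    by simp, ?_, fun v hv => ?_⟩
  · have h := (hasDerivAt_id (0 : ℂ)).mul
      (hψdiff.differentiableAt (ball_mem_nhds 0 hρ)).hasDerivAt.cexp
    exact h.deriv.trans (by simp [hψ0])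
  · rw [hψstep v hv, hΔ v, Complex.exp_add, Complex.exp_add]
    ring
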